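/- For any integers n ≥ 2 and k ∈ {0, 1, ..., n}, there exists x*_{n,k} ∈ [max(0, (k-1)/(n-1)), min(1, k/(n-1))] such that the function x ↦ p_{n,k}(x) is monotone increasing on [0, x*_{n,k}] and monotone decreasing on [x*_{n,k}, 1]. -/

import Mathlib

/-- Rising factorial with increment `h`: `t^{(j,h)} = ∏_{i=0}^{j-1} (t + i·h)`. -/
def risingFac (t h : ℝ) (j : ℕ) : ℝ :=
  ∏ i ∈ Finset.range j, (t + i * h)

/-- The Pólya urn probabilities with minimal negative replacement
`c(x) = −min(x, 1−x)/(n−1)`: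
`p_{n,k}(x) = C(n,k)·x^{(k,c(x))}·(1−x)^{(n−k,c(x))}/1^{(n,c(x))}`. -/
noncomputable def polyaP (n k : ℕ) (x : ℝ) : ℝ :=
  (n.choose k : ℝ)
    * risingFac x (-min x (1 - x) / ((n : ℝ) - 1)) k
    * risingFac (1 - x) (-min x (1 - x) / ((n : ℝ) - 1)) (n - k)
    / risingFac 1 (-min x (1 - x) / ((n : ℝ) - 1)) n

open Finset

noncomputable def qF (m k : ℕ) (y : ℝ) : ℝ :=
  y ^ k * (∏ i ∈ range (m + 1 - k), (1 - ((m : ℝ) + i) * y)) / ∏ j ∈ range (m + 1), (1 - (j : ℝ) * y)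

noncomputable def gF (m k : ℕ) (y : ℝ) : ℝ :=
  (∑ j ∈ range (m + 1), 1 / (1 - (j : ℝ) * y)) - ∑ i ∈ range (m + 1 - k), 1 / (1 - ((m : ℝ) + i) * y)

theorem gF_eq (m k : ℕ) (hk : k ≤ m) (y : ℝ) :
    gF m k y = (∑ j ∈ range m, 1 / (1 - (j : ℝ) * y))
      - ∑ i ∈ range (m - k), 1 / (1 - ((m : ℝ) + 1 + i) * y) := by
  have e : m + 1 - k = (m - k) + 1 := by omega
  unfold gF
  rw [e, sum_range_succ, sum_range_succ']
  have : ∀ i : ℕ, (m : ℝ) + ((i + 1 : ℕ) : ℝ) = (m : ℝ) + 1 + i := by intro i; push_cast; ring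
  simp only [this]
  simp

theorem fac_pos {m : ℕ} {y : ℝ} (hy : 0 ≤ y) (h : 2 * (m : ℝ) * y < 1) {a : ℝ} (ha : a ≤ 2 * m) :
    0 < 1 - a * y := by nlinarith

theorem log_up {a y : ℝ} (ha : 0 < a) (hy : 0 ≤ y) : Real.log (a + y) - Real.log a ≤ y * (1 / a) := by
  have h : 0 < a + y := by linarith
  rw [← Real.log_div h.ne' ha.ne']
  refine (Real.log_le_sub_one_of_pos (by positivity)).trans (le_of_eq ?_)
  field_simp
  ring

theorem log_dn {a y : ℝ} (hy : 0 ≤ y) (ha : 0 < a - y) : y * (1 / a) ≤ Real.log a - Real.log (a - y) := by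
  have h : 0 < a := by linarith
  rw [← Real.log_div h.ne' ha.ne']
  refine le_trans (le_of_eq ?_) (Real.one_sub_inv_le_log_of_pos (by positivity))
  field_simp
  ring

theorem log_mid {a y : ℝ} (hy : 0 ≤ y) (ha : 0 < a - y / 2) :
    y * (1 / a) ≤ Real.log (a + y / 2) - Real.log (a - y / 2) := by
  have h : 0 < a := by linarith
  have hs : |y / (2 * a)| < 1 := by
    rw [abs_of_nonneg (by positivity), div_lt_one (by positivity)]; linarith
  have H := Real.hasSum_log_sub_log_of_abs_lt_one hs
  have h0 := H.summable.sum_le_tsum {0} (fun i _ => by positivity)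
  rw [H.tsum_eq] at h0
  have e1 : 1 + y / (2 * a) = (a + y / 2) / a := by field_simp
  have e2 : 1 - y / (2 * a) = (a - y / 2) / a := by field_simp
  rw [e1, e2, Real.log_div (by positivity) h.ne', Real.log_div ha.ne' h.ne'] at h0
  simp at h0
  have e3 : 2 * (y / (2 * a)) = y * (1 / a) := by field_simp
  linarith

/-- sum bound from below -/
theorem sum_ge (r : ℕ) (y : ℝ) (hy : 0 ≤ y) (hp : ∀ j < r, 0 < 1 - (j : ℝ) * y) :
    Real.log (1 + y) - Real.log (1 - ((r : ℝ) - 1) * y) ≤ y * ∑ j ∈ range r, 1 / (1 - (j : ℝ) * y) := by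
  induction r with
  | zero => simp
  | succ r ih =>
    rw [sum_range_succ, mul_add]
    have h1 := ih (fun j hj => hp j (by omega))
    have h2 := log_up (hp r (by omega)) hy
    have e : 1 - (r : ℝ) * y + y = 1 - ((r : ℝ) - 1) * y := by ring
    rw [e] at h2
    push_cast
    have e2 : (r : ℝ) + 1 - 1 = r := by ring
    rw [e2]
    linarith

/-- sum bound from above -/
theorem sum_le (r : ℕ) (y : ℝ) (hy : 0 ≤ y) (hp : 0 < 1 - (r : ℝ) * y) :
    y * ∑ j ∈ range r, 1 / (1 - (j : ℝ) * y) ≤ - Real.log (1 - (r : ℝ) * y) := by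
  induction r with
  | zero => simp
  | succ r ih =>
    rw [sum_range_succ, mul_add]
    push_cast at hp ⊢
    have h1 := ih (by nlinarith)
    have e : 1 - (r : ℝ) * y - y = 1 - ((r : ℝ) + 1) * y := by ring
    have h2 := log_dn (a := 1 - (r : ℝ) * y) hy (by rw [e]; exact hp)
    rw [e] at h2
    linarith

theorem sum2_ge (r : ℕ) (M y : ℝ) (hy : 0 ≤ y) (hp : 0 < 1 - (M + r) * y) :
    Real.log (1 - M * y) - Real.log (1 - (M + r) * y)
      ≤ y * ∑ i ∈ range r, 1 / (1 - (M + 1 + i) * y) := by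
  induction r with
  | zero => simp
  | succ r ih =>
    rw [sum_range_succ, mul_add]
    push_cast at hp ⊢
    have h1 := ih (by nlinarith)
    have h2 := log_up (a := 1 - (M + 1 + r) * y) (y := y) (by nlinarith) hy
    have e : 1 - (M + 1 + r) * y + y = 1 - (M + r) * y := by ring
    have e2 : M + (r + 1 : ℝ) = M + 1 + r := by ring
    rw [e] at h2
    rw [e2]
    linarith

theorem sum2_le (r : ℕ) (M y : ℝ) (hy : 0 ≤ y) (hp : 0 < 1 - (M + r + 1/2) * y) :
    y * ∑ i ∈ range r, 1 / (1 - (M + 1 + i) * y)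
      ≤ Real.log (1 - (M + 1/2) * y) - Real.log (1 - (M + r + 1/2) * y) := by
  induction r with
  | zero => simp
  | succ r ih =>
    rw [sum_range_succ, mul_add]
    push_cast at hp ⊢
    have h1 := ih (by nlinarith)
    have e : 1 - (M + 1 + r) * y - y / 2 = 1 - (M + (r + 1) + 1/2) * y := by ring
    have e2 : 1 - (M + 1 + r) * y + y / 2 = 1 - (M + r + 1/2) * y := by ring
    have h2 := log_mid (a := 1 - (M + 1 + r) * y) (y := y) hy (by rw [e]; exact hp)
    rw [e, e2] at h2
    linarith

/-- Case A -/
theorem gF_nonneg (m k : ℕ) (hm : 1 ≤ m) (hk : k ≤ m + 1) (h2 : m + 1 ≤ 2 * k) (y : ℝ) (hy : 0 < y)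
    (h : 2 * (m : ℝ) * y < 1) : 0 ≤ gF m k y := by
  have hm' : (1 : ℝ) ≤ m := by exact_mod_cast hm
  have hpos : ∀ j < m + 1, 0 < 1 - (j : ℝ) * y := by
    intro j hj
    have : (j : ℝ) ≤ m := by exact_mod_cast (by omega : j ≤ m)
    exact fac_pos hy.le h (by linarith)
  rcases Nat.lt_or_ge m k with hlt | hle
  · have : m + 1 - k = 0 := by omega
    unfold gF
    rw [this]
    simp only [range_zero, sum_empty, sub_zero]
    exact sum_nonneg fun j hj => (one_div_pos.2 (hpos j (mem_range.1 hj))).le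
  rw [gF_eq m k hle]
  have hk1 : (1 : ℝ) ≤ k := by exact_mod_cast (by omega : 1 ≤ k)
  have hkm : (k : ℝ) ≤ m := by exact_mod_cast hle
  have hk2 : (m : ℝ) + 1 ≤ 2 * k := by exact_mod_cast h2
  have hr : ((m - k : ℕ) : ℝ) = (m : ℝ) - k := by push_cast [hle]; ring
  have A := sum_ge m y hy.le (fun j hj => hpos j (by omega))
  have hq : 0 < 1 - ((m : ℝ) + (m - k : ℕ) + 1/2) * y := fac_pos hy.le h (by rw [hr]; linarith)
  have B := sum2_le (m - k) m y hy.le hq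
  rw [hr] at B hq
  have p1 : 0 < 1 - ((m : ℝ) - 1) * y := fac_pos hy.le h (by linarith)
  have p2 : 0 < 1 - ((m : ℝ) + 1/2) * y := fac_pos hy.le h (by linarith)
  have C : Real.log ((1 - ((m : ℝ) + 1/2) * y) * (1 - ((m : ℝ) - 1) * y))
      ≤ Real.log ((1 + y) * (1 - ((m : ℝ) + (m - k) + 1/2) * y)) := by
    apply Real.log_le_log (by positivity)
    have key : ((m : ℝ)^2 + 3 / 2 * m - k) * y ≤ k := by
      have : 2 * m * (((m : ℝ)^2 + 3 / 2 * m - k) * y) ≤ 2 * m * k := by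
        have : ((m : ℝ)^2 + 3 / 2 * m - k) * (2 * m * y) ≤ ((m : ℝ)^2 + 3 / 2 * m - k) * 1 := by
          apply mul_le_mul_of_nonneg_left h.le; nlinarith
        nlinarith
      exact le_of_mul_le_mul_left this (by positivity)
    nlinarith [mul_le_mul_of_nonneg_left key hy.le]
  rw [Real.log_mul p2.ne' p1.ne', Real.log_mul (by positivity) hq.ne'] at C
  have : 0 ≤ y * ((∑ j ∈ range m, 1 / (1 - (j : ℝ) * y))
      - ∑ i ∈ range (m - k), 1 / (1 - ((m : ℝ) + 1 + i) * y)) := by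
    rw [mul_sub]; linarith
  exact nonneg_of_mul_nonneg_right this hy

theorem gF_anti (m k : ℕ) (hk : 2 * k ≤ m) (y z : ℝ) (hy : 0 ≤ y) (hyz : y ≤ z)
    (h : 2 * (m : ℝ) * z < 1) : gF m k z ≤ gF m k y := by
  have hz : 0 ≤ z := hy.trans hyz
  have h' : 2 * (m : ℝ) * y < 1 := by
    have : 0 ≤ (m : ℝ) := by positivity
    nlinarith
  rw [gF_eq m k (by omega), gF_eq m k (by omega)]
  set D := (1 - (m : ℝ) * y) * (1 - m * z) with hD
  have m0 : (0 : ℝ) ≤ m := by positivity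
  have py : 0 < 1 - (m : ℝ) * y := fac_pos hy h' (by linarith)
  have pz : 0 < 1 - (m : ℝ) * z := fac_pos hz h (by linarith)
  have Dpos : 0 < D := by positivity
  have d0 : 0 ≤ z - y := by linarith
  have L : (∑ j ∈ range m, 1 / (1 - (j : ℝ) * z)) - (∑ j ∈ range m, 1 / (1 - (j : ℝ) * y))
      ≤ (z - y) / D * ∑ j ∈ range m, (j : ℝ) := by
    rw [← sum_sub_distrib, mul_sum]
    refine sum_le_sum fun j hj => ?_
    have hj : (j : ℝ) ≤ m := by exact_mod_cast (mem_range.1 hj).le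
    have qy : 0 < 1 - (j : ℝ) * y := fac_pos hy h' (by linarith)
    have qz : 0 < 1 - (j : ℝ) * z := fac_pos hz h (by linarith)
    have e : 1 / (1 - (j : ℝ) * z) - 1 / (1 - (j : ℝ) * y)
      = (z - y) * j / ((1 - (j : ℝ) * y) * (1 - j * z)) := by field_simp; ring
    rw [e, div_mul_eq_mul_div]
    apply div_le_div_of_nonneg_left (by positivity) Dpos
    apply mul_le_mul _ _ pz.le qy.le <;> nlinarith
  have R : (z - y) / D * ∑ i ∈ range (m - k), ((m : ℝ) + 1)
      ≤ (∑ i ∈ range (m - k), 1 / (1 - ((m : ℝ) + 1 + i) * z))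
        - ∑ i ∈ range (m - k), 1 / (1 - ((m : ℝ) + 1 + i) * y) := by
    rw [← sum_sub_distrib, mul_sum]
    refine sum_le_sum fun i hi => ?_
    have hi : (i : ℝ) + 1 ≤ m := by
      have := mem_range.1 hi
      exact_mod_cast (by omega : i + 1 ≤ m)
    have i0 : (0 : ℝ) ≤ i := by positivity
    have qy : 0 < 1 - ((m : ℝ) + 1 + i) * y := fac_pos hy h' (by linarith)
    have qz : 0 < 1 - ((m : ℝ) + 1 + i) * z := fac_pos hz h (by linarith)
    have e : 1 / (1 - ((m : ℝ) + 1 + i) * z) - 1 / (1 - ((m : ℝ) + 1 + i) * y)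
      = (z - y) * ((m : ℝ) + 1 + i) / ((1 - ((m : ℝ) + 1 + i) * y) * (1 - ((m : ℝ) + 1 + i) * z)) := by
      field_simp; ring
    rw [e, div_mul_eq_mul_div]
    apply div_le_div₀ (by positivity) _ (by positivity)
    · apply mul_le_mul _ _ qz.le py.le <;> nlinarith
    · apply mul_le_mul_of_nonneg_left _ d0; linarith
  have S : ∑ j ∈ range m, (j : ℝ) ≤ ∑ i ∈ range (m - k), ((m : ℝ) + 1) := by
    have h1 : ∀ r : ℕ, 2 * ∑ j ∈ range r, (j : ℝ) = r * (r - 1) := by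
      intro r
      induction r with
      | zero => simp
      | succ r ih => rw [sum_range_succ, mul_add, ih]; push_cast; ring
    have h2 := h1 m
    have hr : ((m - k : ℕ) : ℝ) = (m : ℝ) - k := by push_cast [(by omega : k ≤ m)]; ring
    simp only [sum_const, card_range, nsmul_eq_mul, hr]
    have : 2 * (k : ℝ) ≤ m := by exact_mod_cast hk
    nlinarith
  have := mul_le_mul_of_nonneg_left S (by positivity : 0 ≤ (z - y) / D)
  linarith

theorem gF_up (m k : ℕ) (hm : 1 ≤ m) (hk : 2 * k ≤ m) : gF m k (k / (m : ℝ)^2) ≤ 0 := by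
  have hm' : (1 : ℝ) ≤ m := by exact_mod_cast hm
  rcases Nat.eq_zero_or_pos k with rfl | kp
  · simp [gF]
  have hk' : 2 * (k : ℝ) ≤ m := by exact_mod_cast hk
  have kp' : (0 : ℝ) < k := by exact_mod_cast kp
  set y := (k : ℝ) / (m : ℝ)^2 with hy
  have y0 : 0 < y := by positivity
  have ey : y * m^2 = k := by rw [hy]; field_simp
  have emy : (m : ℝ) * y = k / m := by rw [hy]; field_simp
  have hr : ((m - k : ℕ) : ℝ) = (m : ℝ) - k := by push_cast [(by omega : k ≤ m)]; ring
  have p1 : 0 < 1 - (m : ℝ) * y := by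
    rw [emy, sub_pos, div_lt_one (by positivity)]; linarith
  have e : 1 - ((m : ℝ) + (m - k)) * y = (1 - (m : ℝ) * y)^2 := by rw [hy]; field_simp; ring
  rw [gF_eq m k (by omega)]
  have A := sum_le m y y0.le p1
  have B := sum2_ge (m - k) m y y0.le (by rw [hr, e]; positivity)
  rw [hr, e, Real.log_pow] at B
  push_cast at B
  have : 0 ≤ y * ((∑ i ∈ range (m - k), 1 / (1 - ((m : ℝ) + 1 + i) * y))
     - (∑ j ∈ range m, 1 / (1 - (j : ℝ) * y))) := by
    rw [mul_sub]; linarith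
  linarith [nonneg_of_mul_nonneg_right this y0]

theorem sum2_le' (r : ℕ) (M y : ℝ) (hy : 0 ≤ y) (hp : 0 < 1 - (M + 1 + r) * y) :
    y * ∑ i ∈ range r, 1 / (1 - (M + 1 + i) * y)
      ≤ Real.log (1 - (M + 1) * y) - Real.log (1 - (M + 1 + r) * y) := by
  induction r with
  | zero => simp
  | succ r ih =>
    rw [sum_range_succ, mul_add]
    push_cast at hp ⊢
    have h1 := ih (by nlinarith)
    have e : 1 - (M + 1 + r) * y - y = 1 - (M + 1 + (r + 1)) * y := by ring
    have h2 := log_dn (a := 1 - (M + 1 + r) * y) (y := y) hy (by rw [e]; exact hp)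
    rw [e] at h2
    linarith

theorem gF_dn (m l : ℕ) (hm : 1 ≤ m) (hk : 2 * (l + 1) ≤ m) : 0 ≤ gF m (l + 1) (l / (m : ℝ)^2) := by
  have hm' : (1 : ℝ) ≤ m := by exact_mod_cast hm
  rcases Nat.eq_zero_or_pos l with rfl | kp
  · simp [gF]
  have hk' : 2 * ((l : ℝ) + 1) ≤ m := by exact_mod_cast hk
  have kp' : (0 : ℝ) < l := by exact_mod_cast kp
  set y := (l : ℝ) / (m : ℝ)^2 with hy
  have y0 : 0 < y := by positivity
  have hlt : 2 * (m : ℝ) * y < 1 := by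
    have : 2 * (m : ℝ) * y = 2 * l / m := by rw [hy]; field_simp
    rw [this, div_lt_one (by positivity)]; linarith
  have hr : ((m - (l + 1) : ℕ) : ℝ) = (m : ℝ) - l - 1 := by
    push_cast [(by omega : l + 1 ≤ m)]; ring
  rw [gF_eq m _ (by omega)]
  have A := sum_ge m y y0.le (fun j hj => by
    have : (j : ℝ) ≤ m := by exact_mod_cast hj.le
    exact fac_pos y0.le hlt (by linarith))
  have hq : 0 < 1 - ((m : ℝ) + 1 + (m - l - 1)) * y := fac_pos y0.le hlt (by linarith)
  have B := sum2_le' (m - (l + 1)) m y y0.le (by rw [hr]; exact hq)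
  rw [hr] at B
  have p1 : 0 < 1 - ((m : ℝ) - 1) * y := fac_pos y0.le hlt (by linarith)
  have p2 : 0 < 1 - ((m : ℝ) + 1) * y := fac_pos y0.le hlt (by linarith)
  have C : Real.log ((1 - ((m : ℝ) + 1) * y) * (1 - ((m : ℝ) - 1) * y))
      ≤ Real.log ((1 + y) * (1 - ((m : ℝ) + 1 + (m - l - 1)) * y)) := by
    apply Real.log_le_log (by positivity)
    have e : 1 - ((m : ℝ) + 1 + (m - l - 1)) * y = (1 - (m : ℝ) * y)^2 := by rw [hy]; field_simp; ring
    rw [e]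
    nlinarith [sq_nonneg (1 - (m : ℝ) * y), sq_nonneg y, mul_nonneg y0.le (sq_nonneg (1 - (m : ℝ) * y))]
  rw [Real.log_mul p2.ne' p1.ne', Real.log_mul (by positivity) hq.ne'] at C
  have : 0 ≤ y * ((∑ j ∈ range m, 1 / (1 - (j : ℝ) * y))
      - ∑ i ∈ range (m - (l + 1)), 1 / (1 - ((m : ℝ) + 1 + i) * y)) := by
    rw [mul_sub]; linarith
  exact nonneg_of_mul_nonneg_right this y0

theorem qF_den_pos {m : ℕ} (hm : 1 ≤ m) {y : ℝ} (hy : 0 ≤ y) (h : 2 * (m : ℝ) * y ≤ 1) {j : ℕ}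
    (hj : j ∈ range (m + 1)) : 0 < 1 - (j : ℝ) * y := by
  have hm' : (1 : ℝ) ≤ m := by exact_mod_cast hm
  have : (j : ℝ) ≤ m := by exact_mod_cast (Nat.lt_succ_iff.1 (mem_range.1 hj))
  nlinarith

theorem qF_num_pos {m k : ℕ} {y : ℝ} (hy : 0 ≤ y) (h : 2 * (m : ℝ) * y < 1) {i : ℕ}
    (hi : i ∈ range (m + 1 - k)) : 0 < 1 - ((m : ℝ) + i) * y := by
  have : (i : ℝ) ≤ m := by
    have := mem_range.1 hi
    exact_mod_cast (by omega : i ≤ m)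
  exact fac_pos hy h (by linarith)

theorem qF_diff (m k : ℕ) (hm : 1 ≤ m) (y : ℝ) (hy : 0 ≤ y) (h : 2 * (m : ℝ) * y ≤ 1) :
    DifferentiableAt ℝ (qF m k) y := by
  unfold qF
  apply DifferentiableAt.fun_div
  · fun_prop
  · fun_prop
  · exact prod_ne_zero_iff.2 fun j hj => (qF_den_pos hm hy h hj).ne'

theorem qF_pos (m k : ℕ) (hm : 1 ≤ m) (y : ℝ) (hy : 0 < y) (h : 2 * (m : ℝ) * y < 1) :
    0 < qF m k y := by
  unfold qF
  have := prod_pos fun j hj => qF_den_pos hm hy.le h.le hj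
  have := prod_pos fun j (hj : j ∈ range (m + 1 - k)) => qF_num_pos hy.le h hj
  positivity

theorem qF_logDeriv (m k : ℕ) (hm : 1 ≤ m) (hk : k ≤ m + 1) (y : ℝ) (hy : 0 < y)
    (h : 2 * (m : ℝ) * y < 1) : logDeriv (qF m k) y = gF m k y / y := by
  have hd := fun j hj => (qF_den_pos (j := j) hm hy.le h.le hj).ne'
  have hn := fun j (hj : j ∈ range (m + 1 - k)) => (qF_num_pos hy.le h hj).ne'
  have ld : ∀ a : ℝ, 1 - a * y ≠ 0 →
      logDeriv (fun z => 1 - a * z) y = (1 - 1 / (1 - a * y)) / y := by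
    intro a ha
    have : HasDerivAt (fun z => 1 - a * z) (-a) y := by
      simpa using ((hasDerivAt_id y).const_mul a).const_sub 1
    rw [logDeriv_apply, this.deriv]
    field_simp
    ring
  unfold qF
  rw [logDeriv_div, logDeriv_mul, logDeriv_pow, logDeriv_prod, logDeriv_prod,
    sum_congr rfl (fun i hi => ld _ (hn i hi)), sum_congr rfl (fun i hi => ld _ (hd i hi)),
    ← sum_div, ← sum_div, sum_sub_distrib, sum_sub_distrib]
  · unfold gF
    simp only [sum_const, card_range, nsmul_eq_mul, Nat.cast_sub hk]
    push_cast
    ring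
  · exact hd
  · intros; fun_prop
  · exact hn
  · intros; fun_prop
  · positivity
  · exact prod_ne_zero_iff.2 hn
  · fun_prop
  · fun_prop
  · exact mul_ne_zero (by positivity) (prod_ne_zero_iff.2 hn)
  · exact prod_ne_zero_iff.2 hd
  · fun_prop
  · fun_prop

theorem qF_deriv (m k : ℕ) (hm : 1 ≤ m) (hk : k ≤ m + 1) (y : ℝ) (hy : 0 < y)
    (h : 2 * (m : ℝ) * y < 1) : deriv (qF m k) y = qF m k y * (gF m k y / y) := by
  rw [← qF_logDeriv m k hm hk y hy h, logDeriv_apply, mul_div_cancel₀]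
  exact (qF_pos m k hm y hy h).ne'

theorem two_mul_lt {m : ℕ} (hm : 1 ≤ m) {y : ℝ} (h : y < 1 / (2 * (m : ℝ))) : 2 * (m : ℝ) * y < 1 := by
  have hm' : (1 : ℝ) ≤ m := by exact_mod_cast hm
  rw [lt_div_iff₀ (by positivity)] at h; linarith

theorem two_mul_le {m : ℕ} (hm : 1 ≤ m) {y : ℝ} (h : y ≤ 1 / (2 * (m : ℝ))) : 2 * (m : ℝ) * y ≤ 1 := by
  have hm' : (1 : ℝ) ≤ m := by exact_mod_cast hm
  rw [le_div_iff₀ (by positivity)] at h; linarith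

theorem qF_mono (m k : ℕ) (hm : 1 ≤ m) (hk : k ≤ m + 1) (b : ℝ) (hb : b ≤ 1 / (2 * (m : ℝ)))
    (hg : ∀ y, 0 < y → y < b → 0 ≤ gF m k y) : MonotoneOn (qF m k) (Set.Icc 0 b) := by
  apply monotoneOn_of_deriv_nonneg (convex_Icc 0 b)
  · intro y hy
    exact (qF_diff m k hm y hy.1 (two_mul_le hm (hy.2.trans hb))).continuousAt.continuousWithinAt
  · intro y hy
    rw [interior_Icc] at hy
    exact (qF_diff m k hm y hy.1.le (two_mul_le hm (hy.2.le.trans hb))).differentiableWithinAt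
  · intro y hy
    rw [interior_Icc] at hy
    have h := two_mul_lt hm (hy.2.trans_le hb)
    rw [qF_deriv m k hm hk y hy.1 h]
    exact mul_nonneg (qF_pos m k hm y hy.1 h).le (div_nonneg (hg y hy.1 hy.2) hy.1.le)

theorem qF_antitone (m k : ℕ) (hm : 1 ≤ m) (hk : k ≤ m + 1) (a : ℝ) (ha : 0 ≤ a)
    (hg : ∀ y, a < y → y < 1 / (2 * (m : ℝ)) → gF m k y ≤ 0) :
    AntitoneOn (qF m k) (Set.Icc a (1 / (2 * (m : ℝ)))) := by
  apply antitoneOn_of_deriv_nonpos (convex_Icc _ _)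
  · intro y hy
    exact (qF_diff m k hm y (ha.trans hy.1) (two_mul_le hm hy.2)).continuousAt.continuousWithinAt
  · intro y hy
    rw [interior_Icc] at hy
    exact (qF_diff m k hm y (ha.trans hy.1.le) (two_mul_le hm hy.2.le)).differentiableWithinAt
  · intro y hy
    rw [interior_Icc] at hy
    have h := two_mul_lt hm hy.2
    have y0 : 0 < y := ha.trans_lt hy.1
    rw [qF_deriv m k hm hk y y0 h]
    exact mul_nonpos_of_nonneg_of_nonpos (qF_pos m k hm y y0 h).le
      (div_nonpos_of_nonpos_of_nonneg (hg y hy.1 hy.2) y0.le)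

theorem polyaP_eq (m k : ℕ) (hm : 1 ≤ m) (hk : k ≤ m + 1) : ∃ K : ℝ, 0 ≤ K ∧ ∀ x : ℝ, x ≤ 1 / 2 →
    polyaP (m + 1) k x = K * qF m k (x / m) := by
  have hm' : (1 : ℝ) ≤ m := by exact_mod_cast hm
  have hm0 : (m : ℝ) ≠ 0 := by positivity
  refine ⟨((m + 1).choose k : ℝ) * ∏ i ∈ range k, ((m : ℝ) - i), ?_, ?_⟩
  · refine mul_nonneg (by positivity) (prod_nonneg fun i hi => ?_)
    have := mem_range.1 hi
    have : (i : ℝ) ≤ m := by exact_mod_cast (by omega : i ≤ m)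
    linarith
  · intro x hx
    unfold polyaP risingFac qF
    rw [min_eq_left (by linarith)]
    have e0 : ((m + 1 : ℕ) : ℝ) - 1 = m := by push_cast; ring
    rw [e0]
    have e1 : ∀ i : ℕ, x + (i : ℝ) * (-x / m) = (x / m) * ((m : ℝ) - i) := by
      intro i; field_simp; ring
    have e2 : ∀ i : ℕ, 1 - x + (i : ℝ) * (-x / m) = 1 - ((m : ℝ) + i) * (x / m) := by
      intro i; field_simp; ring
    have e3 : ∀ i : ℕ, 1 + (i : ℝ) * (-x / m) = 1 - (i : ℝ) * (x / m) := by
      intro i; field_simp; ring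
    simp only [e1, e2, e3, prod_mul_distrib, prod_const, card_range]
    ring

theorem polyaP_symm (n k : ℕ) (hk : k ≤ n) (x : ℝ) : polyaP n k x = polyaP n (n - k) (1 - x) := by
  unfold polyaP
  rw [Nat.choose_symm hk, Nat.sub_sub_self hk, sub_sub_cancel, min_comm (1 - x) x]
  ring

theorem polyaP_half (m k : ℕ) (hm : 1 ≤ m) (hk : k ≤ m + 1) (h2 : m + 1 ≤ 2 * k) :
    MonotoneOn (polyaP (m + 1) k) (Set.Icc 0 (1 / 2)) := by
  have hm' : (1 : ℝ) ≤ m := by exact_mod_cast hm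
  obtain ⟨K, hK, hp⟩ := polyaP_eq m k hm hk
  have M := qF_mono m k hm hk _ le_rfl
    (fun y hy hy' => gF_nonneg m k hm hk h2 y hy (two_mul_lt hm hy'))
  have key : ∀ x : ℝ, x ∈ Set.Icc (0 : ℝ) (1 / 2) → x / m ∈ Set.Icc (0 : ℝ) (1 / (2 * (m : ℝ))) := by
    intro x hx
    refine ⟨div_nonneg hx.1 (by linarith), ?_⟩
    rw [← div_div]
    exact div_le_div_of_nonneg_right hx.2 (by linarith)
  intro x hx z hz hxz
  rw [hp x hx.2, hp z hz.2]
  exact mul_le_mul_of_nonneg_left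
    (M (key x hx) (key z hz) (div_le_div_of_nonneg_right hxz (by linarith))) hK

theorem polyaP_half_anti (m k : ℕ) (hm : 1 ≤ m) (h2 : 2 * k ≤ m + 1) :
    AntitoneOn (polyaP (m + 1) k) (Set.Icc (1 / 2) 1) := by
  have M := polyaP_half m (m + 1 - k) hm (by omega) (by omega)
  intro x hx z hz hxz
  rw [polyaP_symm _ k (by omega), polyaP_symm _ k (by omega) x]
  exact M ⟨by linarith [hz.2], by linarith [hz.1]⟩ ⟨by linarith [hx.2], by linarith [hx.1]⟩ (by linarith)

theorem exists_crossing (m k : ℕ) (hm : 1 ≤ m) (hk : 2 * k ≤ m) :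
    ∃ y₀ : ℝ, 0 ≤ y₀ ∧ ((k : ℝ) - 1) / (m : ℝ)^2 ≤ y₀ ∧ y₀ ≤ k / (m : ℝ)^2 ∧
      (∀ y, 0 < y → y < y₀ → 0 ≤ gF m k y) ∧
      (∀ y, y₀ < y → y < 1 / (2 * (m : ℝ)) → gF m k y ≤ 0) := by
  have hm' : (1 : ℝ) ≤ m := by exact_mod_cast hm
  have hk' : 2 * (k : ℝ) ≤ m := by exact_mod_cast hk
  set a : ℝ := max 0 (((k : ℝ) - 1) / (m : ℝ)^2) with ha
  set b : ℝ := k / (m : ℝ)^2 with hb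
  have hb2 : b ≤ 1 / (2 * (m : ℝ)) := by
    rw [hb, div_le_div_iff₀ (by positivity) (by positivity)]; nlinarith
  have hab : a ≤ b := by
    apply max_le (by positivity)
    apply div_le_div_of_nonneg_right (by linarith) (by positivity)
  set S : Set ℝ := {y | a ≤ y ∧ y ≤ b ∧ ∀ z, 0 < z → z < y → 0 ≤ gF m k z} with hS
  have haS : a ∈ S := by
    refine ⟨le_rfl, hab, ?_⟩
    intro z hz hza
    rcases k with _ | l
    · exfalso
      have : (((0 : ℕ) : ℝ) - 1) / (m : ℝ)^2 ≤ 0 := by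
        apply div_nonpos_of_nonpos_of_nonneg <;> simp
      rw [ha, max_eq_left this] at hza
      linarith
    · have e : a = l / (m : ℝ)^2 := by
        rw [ha]; push_cast; rw [add_sub_cancel_right]; exact max_eq_right (by positivity)
      rw [e] at hza
      refine (gF_dn m l hm hk).trans (gF_anti m (l + 1) hk _ _ hz.le hza.le ?_)
      apply two_mul_lt hm
      refine lt_of_lt_of_le ?_ hb2
      rw [hb]
      apply div_lt_div_of_pos_right _ (by positivity)
      push_cast; linarith
  have hbd : BddAbove S := ⟨b, fun y hy => hy.2.1⟩
  have h1 : a ≤ sSup S := le_csSup hbd haS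
  refine ⟨sSup S, (le_max_left _ _).trans h1, (le_max_right _ _).trans h1,
    csSup_le ⟨a, haS⟩ fun y hy => hy.2.1, ?_, ?_⟩
  · intro y hy hy'
    obtain ⟨w, hw, hyw⟩ := exists_lt_of_lt_csSup ⟨a, haS⟩ hy'
    exact hw.2.2 y hy hyw
  · intro y hy hy'
    have hlt := two_mul_lt hm hy'
    rcases le_or_gt b y with hby | hby
    · exact (gF_anti m k hk b y (by positivity) hby hlt).trans (gF_up m k hm hk)
    · have : y ∉ S := fun h => absurd (le_csSup hbd h) (not_le.2 hy)
      simp only [hS, Set.mem_ofPred_eq, not_and, not_forall] at this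
      obtain ⟨w, hw, hwy, hg⟩ := this (h1.trans hy.le) hby.le
      exact (gF_anti m k hk w y hw.le hwy.le hlt).trans (not_le.1 hg).le

theorem polyaP_low (m k : ℕ) (hm : 1 ≤ m) (hk : 2 * k ≤ m) :
    ∃ x₀ : ℝ, 0 ≤ x₀ ∧ ((k : ℝ) - 1) / m ≤ x₀ ∧ x₀ ≤ k / m ∧ x₀ ≤ 1 ∧
      MonotoneOn (polyaP (m + 1) k) (Set.Icc 0 x₀) ∧
      AntitoneOn (polyaP (m + 1) k) (Set.Icc x₀ 1) := by
  have hm' : (1 : ℝ) ≤ m := by exact_mod_cast hm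
  have hk' : 2 * (k : ℝ) ≤ m := by exact_mod_cast hk
  have hm0 : (0 : ℝ) < m := by linarith
  obtain ⟨y₀, h0, h1, h2, h3, h4⟩ := exists_crossing m k hm hk
  obtain ⟨K, hK, hp⟩ := polyaP_eq m k hm (by omega)
  have e1 : ∀ t : ℝ, t / (m : ℝ)^2 * m = t / m := by intro t; field_simp
  have hle : y₀ * m ≤ k / m := by
    rw [← e1]; exact mul_le_mul_of_nonneg_right h2 hm0.le
  have hkm : (k : ℝ) / m ≤ 1 / 2 := by rw [div_le_iff₀ hm0]; linarith
  have hy2 : y₀ ≤ 1 / (2 * (m : ℝ)) := by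
    rw [le_div_iff₀ (by positivity)]; linarith
  have M := qF_mono m k hm (by omega) y₀ hy2 h3
  have A := qF_antitone m k hm (by omega) y₀ h0 h4
  refine ⟨y₀ * m, by positivity, ?_, hle, by linarith, ?_, ?_⟩
  · rw [← e1]; exact mul_le_mul_of_nonneg_right h1 hm0.le
  · have key : ∀ x : ℝ, x ∈ Set.Icc (0 : ℝ) (y₀ * m) → x / m ∈ Set.Icc (0 : ℝ) y₀ := fun x hx =>
      ⟨div_nonneg hx.1 hm0.le, (div_le_iff₀ hm0).2 hx.2⟩
    intro x hx z hz hxz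
    rw [hp x (by linarith [hx.2]), hp z (by linarith [hz.2])]
    exact mul_le_mul_of_nonneg_left
      (M (key x hx) (key z hz) (div_le_div_of_nonneg_right hxz hm0.le)) hK
  · have key : ∀ x : ℝ, x ∈ Set.Icc (y₀ * m) (1 / 2) →
        x / m ∈ Set.Icc y₀ (1 / (2 * (m : ℝ))) := fun x hx =>
      ⟨(le_div_iff₀ hm0).2 hx.1, by
        rw [← div_div]; exact div_le_div_of_nonneg_right hx.2 hm0.le⟩
    have A' : AntitoneOn (polyaP (m + 1) k) (Set.Icc (y₀ * m) (1 / 2)) := by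
      intro x hx z hz hxz
      rw [hp x hx.2, hp z hz.2]
      exact mul_le_mul_of_nonneg_left
        (A (key x hx) (key z hz) (div_le_div_of_nonneg_right hxz hm0.le)) hK
    have B := polyaP_half_anti m k hm (by omega)
    have U := A'.union_right B (isGreatest_Icc (by linarith)) (isLeast_Icc (by norm_num))
    rwa [Set.Icc_union_Icc_eq_Icc (by linarith) (by norm_num)] at U

/-- Theorem 1 of the paper: for `n ≥ 2` and `0 ≤ k ≤ n`, there exists
`x*_{n,k} ∈ [max(0, (k-1)/(n-1)), min(1, k/(n-1))]` such that `p_{n,k}` is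
monotone increasing on `[0, x*_{n,k}]` and monotone decreasing on `[x*_{n,k}, 1]`. -/
theorem polyaP_unimodal (n k : ℕ) (hn : 2 ≤ n) (hk : k ≤ n) :
    ∃ x₀ ∈ Set.Icc (max 0 (((k : ℝ) - 1) / ((n : ℝ) - 1)))
        (min 1 ((k : ℝ) / ((n : ℝ) - 1))),
      MonotoneOn (fun x => polyaP n k x) (Set.Icc 0 x₀) ∧
      AntitoneOn (fun x => polyaP n k x) (Set.Icc x₀ 1) := by
  obtain ⟨m, rfl⟩ : ∃ m, n = m + 1 := ⟨n - 1, by omega⟩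
  have hm : 1 ≤ m := by omega
  have hm' : (1 : ℝ) ≤ m := by exact_mod_cast hm
  have hm0 : (0 : ℝ) < m := by linarith
  have e0 : ((m + 1 : ℕ) : ℝ) - 1 = m := by push_cast; ring
  rw [e0]
  rcases Nat.lt_trichotomy (2 * k) (m + 1) with h | h | h
  · obtain ⟨x₀, h0, h1, h2, h3, h4, h5⟩ := polyaP_low m k hm (by omega)
    exact ⟨x₀, ⟨max_le h0 h1, le_min h3 h2⟩, h4, h5⟩
  · have hk' : 2 * (k : ℝ) = m + 1 := by exact_mod_cast h
    refine ⟨1 / 2, ⟨max_le (by norm_num) ?_, le_min (by norm_num) ?_⟩,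
      polyaP_half m k hm hk (by omega), polyaP_half_anti m k hm (by omega)⟩
    · rw [div_le_iff₀ hm0]; linarith
    · rw [le_div_iff₀ hm0]; linarith
  · obtain ⟨x₀, h0, h1, h2, h3, h4, h5⟩ := polyaP_low m (m + 1 - k) hm (by omega)
    have hr : ((m + 1 - k : ℕ) : ℝ) = (m : ℝ) + 1 - k := by rw [Nat.cast_sub hk]; push_cast; ring
    rw [hr] at h1 h2
    rw [div_le_iff₀ hm0] at h1
    rw [le_div_iff₀ hm0] at h2
    refine ⟨1 - x₀, ⟨max_le (by linarith) ?_, le_min (by linarith) ?_⟩, ?_, ?_⟩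
    · rw [div_le_iff₀ hm0]; linarith
    · rw [le_div_iff₀ hm0]; linarith
    · intro x hx z hz hxz
      change polyaP _ _ _ ≤ polyaP _ _ _
      rw [polyaP_symm _ k hk, polyaP_symm _ k hk z]
      exact h5 ⟨by linarith [hz.2], by linarith [hz.1]⟩ ⟨by linarith [hx.2], by linarith [hx.1]⟩
        (by linarith)
    · intro x hx z hz hxz
      change polyaP _ _ _ ≤ polyaP _ _ _
      rw [polyaP_symm _ k hk, polyaP_symm _ k hk x]
      exact h4 ⟨by linarith [hz.2], by linarith [hz.1]⟩ ⟨by linarith [hx.2], by linarith [hx.1]⟩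
        (by linarith)
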